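/- arXiv:1812.07065 — 2 statements merged into one kernel-verified Lean document; each statement's English description precedes it below -/
import Mathlib

section
/- Let M ∈ ℕ and let w : Fin M → ℂ and x : Fin M → ℂ. Then there exists a sequence a : ℕ → ℂ with Σ_{n=0}^∞ n! · |a n|² ≤ 1 such that for every m the series Σ_{n=0}^∞ (a n) · (w m)ⁿ converges absolutely with sum x m, if and only if the M×M matrix with (j,l) entry exp((w j)·conj(w l)) − (x j)·conj(x l) is positive semidefinite. -/
open ComplexConjugate ComplexOrder

lemma aux_hilbert {H : Type*} [NormedAddCommGroup H] [InnerProductSpace ℂ H] [CompleteSpace H]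
    {M : ℕ} (v : Fin M → H) (x : Fin M → ℂ) :
    (∃ f : H, ‖f‖ ≤ 1 ∧ ∀ m, inner ℂ (v m) f = x m) ↔
    ∀ y : Fin M → ℂ, ‖∑ l, y l * conj (x l)‖ ≤ ‖∑ l, y l • v l‖ := by
  constructor
  · rintro ⟨f, hf, hx⟩ y
    have h : ∑ l, y l * conj (x l) = inner ℂ f (∑ l, y l • v l) := by
      rw [inner_sum]
      refine Finset.sum_congr rfl fun l _ => ?_
      rw [inner_smul_right, ← hx l, inner_conj_symm]
    rw [h]
    calc _ ≤ ‖f‖ * ‖∑ l, y l • v l‖ := norm_inner_le_norm _ _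
      _ ≤ 1 * ‖∑ l, y l • v l‖ := by gcongr
      _ = _ := one_mul _
  · intro h
    let T : (Fin M → ℂ) →ₗ[ℂ] H := Fintype.linearCombination ℂ v
    let φ : (Fin M → ℂ) →ₗ[ℂ] ℂ := Fintype.linearCombination ℂ (fun l => conj (x l))
    have hφ : ∀ y, ‖φ y‖ ≤ ‖T y‖ := by
      intro y
      simpa [T, φ, Fintype.linearCombination_apply] using h y
    obtain ⟨s, hs⟩ := T.rangeRestrict.exists_rightInverse_of_surjective T.range_rangeRestrict
    have hs' : ∀ u : LinearMap.range T, T (s u) = u := fun u => by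
      have := congrArg Subtype.val (LinearMap.congr_fun hs u)
      simpa using this
    let g : LinearMap.range T →L[ℂ] ℂ := (φ ∘ₗ s).mkContinuous 1 (fun u => by
      have := hφ (s u)
      rw [hs'] at this
      simpa using this)
    have hg : ‖g‖ ≤ 1 := LinearMap.mkContinuous_norm_le _ zero_le_one _
    obtain ⟨G, hG, hGn⟩ := exists_extension_norm_eq (LinearMap.range T) g
    refine ⟨(InnerProductSpace.toDual ℂ H).symm G, ?_, ?_⟩
    · rw [LinearIsometryEquiv.norm_map, hGn]; exact hg
    · intro m
      rw [← inner_conj_symm, InnerProductSpace.toDual_symm_apply]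
      have hTm : T (Pi.single m 1) = v m := by simp [T]
      have hφm : φ (Pi.single m 1) = conj (x m) := by simp [φ]
      let u : LinearMap.range T := ⟨v m, ⟨_, hTm⟩⟩
      have h1 : G (v m) = φ (s u) := hG u
      have h2 : φ (s u) = φ (Pi.single m 1) := by
        rw [← sub_eq_zero, ← map_sub, ← norm_le_zero_iff]
        refine (hφ _).trans ?_
        rw [map_sub, hs', hTm]; simp [u]
      rw [h1, h2, hφm, Complex.conj_conj]

lemma aux_exp (z : ℂ) : HasSum (fun n : ℕ => z ^ n / (n.factorial : ℂ)) (Complex.exp z) := by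
  rw [Complex.exp_eq_exp_ℂ]
  exact NormedSpace.expSeries_div_hasSum_exp z

lemma aux_sqrt (n : ℕ) : ((Real.sqrt n.factorial : ℝ) : ℂ) * (Real.sqrt n.factorial : ℝ) = n.factorial := by
  rw [← Complex.ofReal_mul, Real.mul_self_sqrt (by positivity)]; simp

lemma aux_sqrt_ne (n : ℕ) : ((Real.sqrt n.factorial : ℝ) : ℂ) ≠ 0 := by
  rw [Complex.ofReal_ne_zero]
  exact (Real.sqrt_pos.2 (by positivity)).ne'

lemma aux_memk (w : ℂ) :
    Memℓp (fun n : ℕ => conj w ^ n / ((Real.sqrt n.factorial : ℝ) : ℂ)) 2 := by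
  rw [memℓp_gen_iff (by norm_num)]
  have := Real.summable_pow_div_factorial (‖w‖ ^ 2)
  refine this.congr fun n => ?_
  simp only [ENNReal.toReal_ofNat, Real.rpow_two]
  rw [norm_div, div_pow, norm_pow, Complex.norm_real, Real.norm_eq_abs, sq_abs,
    Real.sq_sqrt (by positivity), RCLike.norm_conj]
  ring

/-- normalized kernel coefficient vector -/
noncomputable def auxK (w : ℂ) : lp (fun _ : ℕ => ℂ) 2 := ⟨_, aux_memk w⟩

lemma auxK_apply (w : ℂ) (n : ℕ) :
    auxK w n = conj w ^ n / ((Real.sqrt n.factorial : ℝ) : ℂ) := rfl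

lemma auxK_inner (w z : ℂ) : inner ℂ (auxK w) (auxK z) = Complex.exp (w * conj z) := by
  refine (lp.hasSum_inner (auxK w) (auxK z)).unique ?_
  have h : (fun n : ℕ => inner ℂ (auxK w n) (auxK z n)) =
      fun n : ℕ => (w * conj z) ^ n / (n.factorial : ℂ) := by
    funext n
    rw [RCLike.inner_apply, auxK_apply, auxK_apply, ← aux_sqrt n]
    have := aux_sqrt_ne n
    simp only [map_div₀, map_pow, Complex.conj_conj, Complex.conj_ofReal]
    field_simp
    rw [mul_pow, mul_comm]
  rw [h]
  exact aux_exp _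

lemma aux_term (w : ℂ) (f : lp (fun _ : ℕ => ℂ) 2) (n : ℕ) :
    inner ℂ (auxK w n) (f n) = (f n / ((Real.sqrt n.factorial : ℝ) : ℂ)) * w ^ n := by
  rw [RCLike.inner_apply, auxK_apply]
  simp only [map_div₀, map_pow, Complex.conj_conj, Complex.conj_ofReal]
  ring

lemma aux_form {H : Type*} [NormedAddCommGroup H] [InnerProductSpace ℂ H]
    {M : ℕ} (v : Fin M → H) (x y : Fin M → ℂ) :
    ∑ j, ∑ l, conj (y j) * (inner ℂ (v j) (v l) - x j * conj (x l)) * y l =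
      ((‖∑ l, y l • v l‖ ^ 2 - ‖∑ l, y l * conj (x l)‖ ^ 2 : ℝ) : ℂ) := by
  have h1 : ((‖∑ l, y l • v l‖ ^ 2 : ℝ) : ℂ) =
      ∑ j, ∑ l, conj (y j) * inner ℂ (v j) (v l) * y l := by
    have := inner_self_eq_norm_sq_to_K (𝕜 := ℂ) (∑ l, y l • v l)
    push_cast
    refine this.symm.trans ?_
    rw [sum_inner]
    refine Finset.sum_congr rfl fun j _ => ?_
    rw [inner_sum]
    refine Finset.sum_congr rfl fun l _ => ?_
    rw [inner_smul_left, inner_smul_right]; ring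
  have h2 : ((‖∑ l, y l * conj (x l)‖ ^ 2 : ℝ) : ℂ) =
      ∑ j, ∑ l, conj (y j) * (x j * conj (x l)) * y l := by
    push_cast
    rw [← Complex.conj_mul', map_sum, Finset.sum_mul_sum]
    refine Finset.sum_congr rfl fun j _ => Finset.sum_congr rfl fun l _ => ?_
    simp only [map_mul, Complex.conj_conj]; ring
  rw [Complex.ofReal_sub, h1, h2, ← Finset.sum_sub_distrib]
  refine Finset.sum_congr rfl fun j _ => ?_
  rw [← Finset.sum_sub_distrib]
  refine Finset.sum_congr rfl fun l _ => ?_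
  ring

lemma aux_fock (M : ℕ) (w x : Fin M → ℂ) :
    (∃ a : ℕ → ℂ,
      Summable (fun n : ℕ => (n.factorial : ℝ) * ‖a n‖ ^ 2) ∧
      (∑' n : ℕ, (n.factorial : ℝ) * ‖a n‖ ^ 2) ≤ 1 ∧
      ∀ m : Fin M, Summable (fun n : ℕ => ‖a n * (w m) ^ n‖) ∧
        ∑' n : ℕ, a n * (w m) ^ n = x m) ↔
    ∃ f : lp (fun _ : ℕ => ℂ) 2, ‖f‖ ≤ 1 ∧ ∀ m, inner ℂ (auxK (w m)) f = x m := by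
  have hnorm : ∀ f : lp (fun _ : ℕ => ℂ) 2, ‖f‖ ^ 2 = ∑' n, ‖f n‖ ^ 2 := by
    intro f
    have := lp.norm_rpow_eq_tsum (p := 2) (by norm_num) f
    simpa using this
  have hone : ∀ f : lp (fun _ : ℕ => ℂ) 2, ‖f‖ ≤ 1 ↔ ‖f‖ ^ 2 ≤ 1 := fun f =>
    (sq_le_one_iff₀ (norm_nonneg f)).symm
  constructor
  · rintro ⟨a, ha, ha1, hx⟩
    have hsq : ∀ n : ℕ, ‖((Real.sqrt n.factorial : ℝ) : ℂ) * a n‖ ^ 2 =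
        (n.factorial : ℝ) * ‖a n‖ ^ 2 := fun n => by
      rw [norm_mul, mul_pow, Complex.norm_real, Real.norm_eq_abs, sq_abs,
        Real.sq_sqrt (by positivity)]
    have hmem : Memℓp (fun n : ℕ => ((Real.sqrt n.factorial : ℝ) : ℂ) * a n) 2 := by
      rw [memℓp_gen_iff (by norm_num)]
      refine ha.congr fun n => ?_
      simp only [ENNReal.toReal_ofNat, Real.rpow_two]
      rw [hsq]
    let f : lp (fun _ : ℕ => ℂ) 2 := ⟨_, hmem⟩
    have hf : ∀ n, f n = ((Real.sqrt n.factorial : ℝ) : ℂ) * a n := fun n => rfl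
    refine ⟨f, ?_, fun m => ?_⟩
    · rw [hone, hnorm]
      simp only [hf, hsq]
      exact ha1
    · rw [lp.inner_eq_tsum, ← (hx m).2]
      refine tsum_congr fun n => ?_
      rw [aux_term, hf, mul_div_cancel_left₀ _ (aux_sqrt_ne n)]
  · rintro ⟨f, hf, hx⟩
    have hsq : ∀ n : ℕ, (n.factorial : ℝ) * ‖f n / ((Real.sqrt n.factorial : ℝ) : ℂ)‖ ^ 2 =
        ‖f n‖ ^ 2 := fun n => by
      rw [norm_div, div_pow, Complex.norm_real, Real.norm_eq_abs, sq_abs,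
        Real.sq_sqrt (by positivity)]
      field_simp
    refine ⟨fun n => f n / ((Real.sqrt n.factorial : ℝ) : ℂ), ?_, ?_, fun m => ⟨?_, ?_⟩⟩
    · simp only [hsq]
      have := (memℓp_gen_iff (p := 2) (by norm_num)).1 (lp.memℓp f)
      simpa using this
    · simp only [hsq]
      rw [← hnorm, ← hone]; exact hf
    · have := (lp.summable_inner (𝕜 := ℂ) (auxK (w m)) f).norm
      simpa only [aux_term] using this
    · rw [← hx m, lp.inner_eq_tsum]
      exact tsum_congr fun n => (aux_term _ _ _).symm

/-- Nevanlinna–Pick interpolation in the Fock space: there exists `f(z) = Σ aₙ zⁿ` with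
`Σ n!|aₙ|² ≤ 1` and `f (w m) = x m` for all `m` iff the matrix with entries
`exp(w j · conj (w l)) − x j · conj (x l)` is positive semidefinite. -/
theorem stmt5 (M : ℕ) (w x : Fin M → ℂ) :
    (∃ a : ℕ → ℂ,
      Summable (fun n : ℕ => (n.factorial : ℝ) * ‖a n‖ ^ 2) ∧
      (∑' n : ℕ, (n.factorial : ℝ) * ‖a n‖ ^ 2) ≤ 1 ∧
      ∀ m : Fin M, Summable (fun n : ℕ => ‖a n * (w m) ^ n‖) ∧
        ∑' n : ℕ, a n * (w m) ^ n = x m) ↔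
    (∀ y : Fin M → ℂ,
      0 ≤ ∑ j : Fin M, ∑ l : Fin M,
        conj (y j) * (Complex.exp (w j * conj (w l)) - x j * conj (x l)) * y l) := by
  rw [aux_fock, aux_hilbert]
  refine forall_congr' fun y => ?_
  simp only [← auxK_inner]
  rw [aux_form (fun m => auxK (w m)) x y, Complex.zero_le_real, sub_nonneg,
    sq_le_sq₀ (norm_nonneg _) (norm_nonneg _)]
end

section
/- Let 𝒮 : 𝔻 → L(ℓ²(ℕ,ℂ), ℂ) be analytic with ‖𝒮 z‖ ≤ 1 for all z ∈ 𝔻 (a Schur function), with associated kernel K_𝒮(z,w) = (1 − 𝒮(z)((𝒮 w)* 1)) / (1 − z·conj w), and let h : 𝔻 → ℂ. Then the scalar kernel (z,w) ↦ K_𝒮(z,w) − h(z)·conj(h(w)) is positive semidefinite on 𝔻 (i.e. h belongs to the de Branges–Rovnyak space H(K_𝒮) with norm at most 1) if and only if there exist analytic maps Σ₁₁ : 𝔻 → L(ℓ²(ℕ,ℂ), ℂ), Σ₁₂ : 𝔻 → ℂ, Σ₂₁ : 𝔻 → L(ℓ²(ℕ,ℂ), ℂ), Σ₂₂ : 𝔻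 → ℂ such that for every z ∈ 𝔻 the block operator (u, λ) ↦ (Σ₁₁(z)u + Σ₁₂(z)λ, Σ₂₁(z)u + Σ₂₂(z)λ) from ℓ²(ℕ,ℂ) × ℂ to ℂ × ℂ has operator norm ≤ 1, and for all z ∈ 𝔻: h(z) = Σ₁₂(z)·(1 − z·Σ₂₂(z))⁻¹ and 𝒮(z) = Σ₁₁(z) + z·Σ₁₂(z)·(1 − z·Σ₂₂(z))⁻¹ · Σ₂₁(z) (note that |z·Σ₂₂(z)| < 1, so 1 − z·Σ₂₂(z) ≠ 0). -/
open ComplexConjugate ComplexOrder Metric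

lemma exists_of_psd {X : Type} (M : Matrix X X (ℂ →L[ℂ] ℂ)) (hM : M.PosSemidef) :
    ∃ (H : Type) (_ : NormedAddCommGroup H) (_ : InnerProductSpace ℂ H) (_ : CompleteSpace H)
      (g : X → H), ∀ x y, inner ℂ (g x) (g y) = M x y 1 := by
  have : Fact M.PosSemidef := ⟨hM⟩
  refine ⟨RKHS.OfKernel M, inferInstance, inferInstance, inferInstance,
    fun x => RKHS.kerFun (RKHS.OfKernel M) x 1, fun x y => ?_⟩
  have h1 := RKHS.kernel_inner (RKHS.OfKernel M) x y 1 1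
  rw [RKHS.OfKernel.kernel_ofKernel] at h1
  rw [← inner_conj_symm, ← h1]
  simp

lemma exists_kernel_factor {X : Type} (K : X → X → ℂ) (hK : ∀ x y, conj (K y x) = K x y)
    (hpos : ∀ (N : ℕ) (x : Fin N → X) (y : Fin N → ℂ),
      0 ≤ ∑ i : Fin N, ∑ j : Fin N, conj (y i) * y j * K (x i) (x j)) :
    ∃ (H : Type) (_ : NormedAddCommGroup H) (_ : InnerProductSpace ℂ H) (_ : CompleteSpace H)
      (g : X → H), ∀ x y, inner ℂ (g x) (g y) = K x y := by
  let M : Matrix X X (ℂ →L[ℂ] ℂ) := fun x y => K x y • ContinuousLinearMap.id ℂ ℂ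
  have hM : M.PosSemidef := by
    have htfae := (RKHS.posSemidef_tfae (K := M)).out 0 2
    rw [htfae]
    refine ⟨?_, ?_⟩
    · ext x y
      rw [Matrix.conjTranspose_apply]
      simp [M, ContinuousLinearMap.star_eq_adjoint, hK, ContinuousLinearMap.adjoint_id]
    · intro vv
      have h1 := hpos vv.support.card (fun i => (vv.support.equivFin.symm i : X))
        (fun i => vv (vv.support.equivFin.symm i : X))
      have h2 : (∑ i : Fin vv.support.card, ∑ j : Fin vv.support.card,
          conj (vv (vv.support.equivFin.symm i : X)) * vv (vv.support.equivFin.symm j : X) *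
            K (vv.support.equivFin.symm i : X) (vv.support.equivFin.symm j : X))
          = ∑ x ∈ vv.support, ∑ y ∈ vv.support, conj (vv x) * vv y * K x y := by
        rw [← Finset.sum_coe_sort vv.support (fun x => ∑ y ∈ vv.support, conj (vv x) * vv y * K x y),
          ← Equiv.sum_comp vv.support.equivFin.symm]
        refine Finset.sum_congr rfl fun i _ => ?_
        rw [← Finset.sum_coe_sort vv.support, ← Equiv.sum_comp vv.support.equivFin.symm]
      rw [h2] at h1
      have h3 := (Complex.le_def.mp h1).1
      have h4 : (vv.sum fun x w => vv.sum fun x' w' => inner ℂ ((M x' x) w) w')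
          = ∑ x ∈ vv.support, ∑ y ∈ vv.support, conj (vv x) * vv y * K x y := by
        simp only [Finsupp.sum, M]
        refine Finset.sum_congr rfl fun i _ => Finset.sum_congr rfl fun j _ => ?_
        simp [hK]
        ring
      rw [h4]
      exact h3
  obtain ⟨H, i1, i2, i3, g, hg⟩ := exists_of_psd M hM
  refine ⟨H, i1, i2, i3, g, fun x y => ?_⟩
  rw [hg]
  simp [M]

lemma exists_contraction {ι X₁ X₂ : Type*} [NormedAddCommGroup X₁] [InnerProductSpace ℂ X₁]
    [CompleteSpace X₁] [NormedAddCommGroup X₂] [InnerProductSpace ℂ X₂] [CompleteSpace X₂]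
    (p : ι → X₁) (q : ι → X₂) (hpq : ∀ i j, inner ℂ (p i) (p j) = inner ℂ (q i) (q j)) :
    ∃ V : X₁ →L[ℂ] X₂, ‖V‖ ≤ 1 ∧ ∀ i, V (p i) = q i := by
  let La := Finsupp.linearCombination ℂ p
  let Lb := Finsupp.linearCombination ℂ q
  have hn : ∀ x, ‖Lb x‖ = ‖La x‖ := by
    intro x
    rw [← sq_eq_sq₀ (norm_nonneg _) (norm_nonneg _), ← inner_self_eq_norm_sq (𝕜 := ℂ),
      ← inner_self_eq_norm_sq (𝕜 := ℂ)]
    congr 1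
    simp only [La, Lb, Finsupp.linearCombination_apply, Finsupp.sum_inner, Finsupp.inner_sum,
      inner_smul_left, inner_smul_right, hpq]
  let S : Submodule ℂ X₁ := (LinearMap.range La).topologicalClosure
  have hS : ∀ x, La x ∈ S := fun x =>
    Submodule.le_topologicalClosure _ (LinearMap.mem_range_self La x)
  have : CompleteSpace S := (Submodule.isClosed_topologicalClosure _).completeSpace_coe
  let e : (ι →₀ ℂ) →ₗ[ℂ] S := La.codRestrict S hS
  have hd : DenseRange e := by
    intro y
    rw [closure_subtype]
    have : (Subtype.val '' Set.range e) = (LinearMap.range La : Set X₁) := by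
      ext t; simp [e]
    rw [this]
    exact y.2
  have hne : ∀ x, ‖Lb x‖ ≤ 1 * ‖e x‖ := by
    intro x
    rw [one_mul, hn]; rfl
  refine ⟨(Lb.extendOfNorm e) ∘L S.orthogonalProjectionOnto, ?_, ?_⟩
  · refine (ContinuousLinearMap.opNorm_comp_le _ _).trans ?_
    have h1 := LinearMap.opNorm_extendOfNorm_le hd zero_le_one hne
    have h2 := S.orthogonalProjectionOnto_norm_le
    calc _ ≤ (1:ℝ) * 1 := by gcongr
      _ = 1 := one_mul 1
  · intro i
    have h1 : p i = ((e (Finsupp.single i 1) : S) : X₁) := by simp [e, La]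
    rw [ContinuousLinearMap.comp_apply, h1, Submodule.orthogonalProjectionOnto_mem_subspace_eq_self,
      LinearMap.extendOfNorm_eq hd ⟨1, hne⟩]
    simp [Lb]

lemma leech_realization {E F H : Type*} [NormedAddCommGroup E] [InnerProductSpace ℂ E]
    [CompleteSpace E] [NormedAddCommGroup F] [InnerProductSpace ℂ F] [CompleteSpace F]
    [NormedAddCommGroup H] [InnerProductSpace ℂ H] [CompleteSpace H]
    (a : ℂ → F) (b : ℂ → E) (g : ball (0 : ℂ) 1 → H)
    (hab : ∀ z w : ball (0 : ℂ) 1, inner ℂ (a z) (a w) + z * conj (w : ℂ) * inner ℂ (g z) (g w)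
      = inner ℂ (b z) (b w) + inner ℂ (g z) (g w)) :
    ∃ T : ℂ → (E →L[ℂ] F), DifferentiableOn ℂ T (ball 0 1) ∧
      (∀ z ∈ ball (0 : ℂ) 1, ∀ e, ‖T z e‖ ≤ ‖e‖) ∧
      (∀ z ∈ ball (0 : ℂ) 1, ∀ e, inner ℂ (a z) (T z e) = inner ℂ (b z) e) := by
  let p : ball (0 : ℂ) 1 → WithLp 2 (F × H) := fun z =>
    WithLp.toLp 2 (a z, conj (z : ℂ) • g z)
  let q : ball (0 : ℂ) 1 → WithLp 2 (E × H) := fun z => WithLp.toLp 2 (b z, g z)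
  obtain ⟨V, hV, hVpq⟩ := exists_contraction p q (by
    intro z w
    simp only [p, q, WithLp.prod_inner_apply, inner_smul_left, inner_smul_right, ← hab]
    simp; ring)
  let W : WithLp 2 (E × H) →L[ℂ] WithLp 2 (F × H) := ContinuousLinearMap.adjoint V
  have hW : ‖W‖ ≤ 1 := (ContinuousLinearMap.adjoint.norm_map V).trans_le hV
  let cE : E × H →L[ℂ] WithLp 2 (E × H) :=
    (WithLp.prodContinuousLinearEquiv 2 ℂ E H).symm.toContinuousLinearMap
  let jE : E →L[ℂ] WithLp 2 (E × H) := cE ∘L ContinuousLinearMap.inl ℂ E H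
  let jH : H →L[ℂ] WithLp 2 (E × H) := cE ∘L ContinuousLinearMap.inr ℂ E H
  let cF : WithLp 2 (F × H) →L[ℂ] F × H :=
    (WithLp.prodContinuousLinearEquiv 2 ℂ F H).toContinuousLinearMap
  let pF : WithLp 2 (F × H) →L[ℂ] F := ContinuousLinearMap.fst ℂ F H ∘L cF
  let pH : WithLp 2 (F × H) →L[ℂ] H := ContinuousLinearMap.snd ℂ F H ∘L cF
  have hj : ∀ e x, ‖jE e + jH x‖ ^ 2 = ‖e‖ ^ 2 + ‖x‖ ^ 2 := by
    intro e x
    rw [WithLp.prod_norm_sq_eq_of_L2]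
    simp [jE, jH, cE]
  have hjH : ∀ x, ‖jH x‖ ≤ ‖x‖ := by
    intro x
    have := hj 0 x
    simp only [map_zero, zero_add, norm_zero] at this
    nlinarith [norm_nonneg (jH x), norm_nonneg x]
  have hp : ∀ t, ‖t‖ ^ 2 = ‖pF t‖ ^ 2 + ‖pH t‖ ^ 2 := by
    intro t
    rw [WithLp.prod_norm_sq_eq_of_L2]
    simp [pF, pH, cF]
  have hpH : ∀ t, ‖pH t‖ ≤ ‖t‖ := by
    intro t
    have := hp t
    nlinarith [norm_nonneg (pH t), norm_nonneg t, norm_nonneg (pF t)]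
  have hWx : ∀ x, ‖W x‖ ≤ ‖x‖ := fun x => by
    simpa using W.le_of_opNorm_le hW x
  let A : H →L[ℂ] H := pH ∘L W ∘L jH
  let B : E →L[ℂ] H := pH ∘L W ∘L jE
  have hA : ‖A‖ ≤ 1 := by
    refine ContinuousLinearMap.opNorm_le_bound _ zero_le_one fun x => ?_
    rw [one_mul]
    exact (hpH _).trans ((hWx _).trans (hjH _))
  let R : ℂ → (H →L[ℂ] H) := fun z => Ring.inverse (1 - z • A)
  have hu : ∀ z ∈ ball (0 : ℂ) 1, IsUnit (1 - z • A) := by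
    intro z hz
    refine isUnit_one_sub_of_norm_lt_one ?_
    rw [mem_ball_zero_iff] at hz
    rw [norm_smul]
    nlinarith [norm_nonneg z, norm_nonneg A]
  let T : ℂ → (E →L[ℂ] F) := fun z => (pF ∘L W) ∘L (jE + z • (jH ∘L (R z ∘L B)))
  have key : ∀ z ∈ ball (0 : ℂ) 1, ∀ e, ∃ x : H, pF (W (jE e + jH (z • x))) = T z e ∧
      pH (W (jE e + jH (z • x))) = x := by
    intro z hz e
    refine ⟨R z (B e), ?_, ?_⟩
    · simp [T]
    · have h1 : (1 - z • A) * R z = 1 := Ring.mul_inverse_cancel _ (hu z hz)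
      have h2 := congrArg (fun L : H →L[ℂ] H => L (B e)) h1
      simp only [mul_apply_eq_comp, sub_apply,
        one_apply_eq_self, smul_apply] at h2
      have h3 : pH (W (jE e + jH (z • R z (B e)))) = B e + z • A (R z (B e)) := by
        simp [A, B]
      rw [h3]
      exact (sub_eq_iff_eq_add.mp h2).symm
  refine ⟨T, ?_, ?_, ?_⟩
  · intro z hz
    have hR : DifferentiableAt ℂ R z := by
      have h1 : DifferentiableAt ℂ (fun z : ℂ => (1 - z • A : H →L[ℂ] H)) z := by fun_prop
      have h2 := differentiableAt_inverse (𝕜 := ℂ) (hu z hz)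
      exact h2.comp z h1
    have : DifferentiableAt ℂ T z := by
      refine (differentiableAt_const _).clm_comp ?_
      refine (differentiableAt_const _).add ?_
      have hid : DifferentiableAt ℂ (fun w : ℂ => w) z := by fun_prop
      refine hid.smul ?_
      refine (differentiableAt_const _).clm_comp ?_
      exact hR.clm_comp (differentiableAt_const _)
    exact this.differentiableWithinAt
  · intro z hz e
    obtain ⟨x, h1, h2⟩ := key z hz e
    have h3 := hp (W (jE e + jH (z • x)))
    rw [h1, h2] at h3
    have h4 := hWx (jE e + jH (z • x))
    have h5 := hj e (z • x)
    rw [norm_smul] at h5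
    rw [mem_ball_zero_iff] at hz
    have h6 : ‖z‖ * ‖x‖ ≤ ‖x‖ := by nlinarith [norm_nonneg x]
    have h7 : ‖W (jE e + jH (z • x))‖ ^ 2 ≤ ‖jE e + jH (z • x)‖ ^ 2 := by gcongr
    have h8 : (‖z‖ * ‖x‖) ^ 2 ≤ ‖x‖ ^ 2 := by gcongr
    refine (sq_le_sq₀ (norm_nonneg _) (norm_nonneg _)).mp ?_
    linarith
  · intro z hz e
    obtain ⟨x, h1, h2⟩ := key z hz e
    have h3 : inner ℂ (p ⟨z, hz⟩) (W (jE e + jH (z • x))) =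
        inner ℂ (q ⟨z, hz⟩) (jE e + jH (z • x)) := by
      rw [← hVpq, ContinuousLinearMap.adjoint_inner_right]
    have h4 : ∀ t, inner ℂ (p ⟨z, hz⟩) t = inner ℂ (a z) (pF t) + z * inner ℂ (g ⟨z, hz⟩) (pH t) := by
      intro t
      simp [p, pF, pH, cF, WithLp.prod_inner_apply, inner_smul_left]
    have h5 : inner ℂ (q ⟨z, hz⟩) (jE e + jH (z • x)) =
        inner ℂ (b z) e + z * inner ℂ (g ⟨z, hz⟩) x := by
      simp [q, jE, jH, cE, WithLp.prod_inner_apply]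
    rw [h4, h1, h2, h5] at h3
    exact add_right_cancel h3

lemma schur_avg {E F : Type*} [NormedAddCommGroup E] [InnerProductSpace ℂ E]
    [NormedAddCommGroup F] [InnerProductSpace ℂ F]
    (T : ℂ → (E →L[ℂ] F))
    (hT : ∀ f e, DifferentiableOn ℂ (fun z => inner ℂ f (T z e)) (ball 0 1))
    (hc : ∀ z ∈ ball (0 : ℂ) 1, ∀ e, ‖T z e‖ ≤ ‖e‖)
    (ρ : ℝ) (hρ0 : 0 < ρ) (hρ1 : ρ < 1)
    (N : ℕ) (z : Fin N → ℂ) (hz : ∀ i, z i ∈ ball (0 : ℂ) 1) (r : Fin N → F) (g : Fin N → E) :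
    0 ≤ (∑ i : Fin N, ∑ j : Fin N, (1 - z i * conj (z j))⁻¹ *
      (inner ℂ (r i) (r j) - 2 * inner ℂ (r i) (T (ρ * z i) (g j)) + inner ℂ (g i) (g j))).re := by
  let φ : Fin N → Fin N → ℂ → ℂ := fun i j ζ => (1 - ζ * conj (z j))⁻¹ *
      (inner ℂ (r i) (r j) - 2 * inner ℂ (r i) (T (ρ * ζ) (g j)) + inner ℂ (g i) (g j))
  have hne : ∀ j, ∀ ζ ∈ closedBall (0 : ℂ) 1, 1 - ζ * conj (z j) ≠ 0 := by
    intro j ζ hζ h0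
    have h1 : ‖ζ * conj (z j)‖ = 1 := by rw [← sub_eq_zero.mp h0]; simp
    have h2 := hz j
    rw [mem_ball_zero_iff] at h2
    rw [mem_closedBall_zero_iff] at hζ
    rw [norm_mul, RCLike.norm_conj] at h1
    nlinarith [norm_nonneg ζ, norm_nonneg (z j)]
  have hφ : ∀ i j, DifferentiableOn ℂ (φ i j) (closedBall 0 1) := by
    intro i j
    refine DifferentiableOn.mul ?_ ?_
    · refine DifferentiableOn.inv (by fun_prop) (hne j)
    · have h1 : DifferentiableOn ℂ (fun ζ => inner ℂ (r i) (T (ρ * ζ) (g j)) : ℂ → ℂ)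
          (closedBall 0 1) := by
        refine (hT (r i) (g j)).comp (f := fun ζ : ℂ => (ρ : ℂ) * ζ) (by fun_prop) ?_
        intro ζ hζ
        rw [mem_closedBall_zero_iff] at hζ
        rw [mem_ball_zero_iff, norm_mul, Complex.norm_real, Real.norm_of_nonneg hρ0.le]
        nlinarith [norm_nonneg ζ]
      fun_prop
  have hdc : ∀ i j, DiffContOnCl ℂ (φ i j) (ball 0 |1|) := by
    intro i j
    refine DifferentiableOn.diffContOnCl ?_
    rw [abs_one, closure_ball _ one_ne_zero]
    exact hφ i j
  let Ψ : Fin N → Fin N → ℂ → ℂ := fun i j ζ => ((ζ - 0) / (ζ - z i)) • φ i j ζ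
  have hav : ∀ i j, Real.circleAverage (Ψ i j) 0 1 = φ i j (z i) := fun i j =>
    (hdc i j).circleAverage_smul_div (by simpa using hz i)
  have hsub : ∀ i, ∀ ζ ∈ sphere (0 : ℂ) 1, ζ - z i ≠ 0 := by
    intro i ζ hζ h0
    have := hz i
    rw [← sub_eq_zero.mp h0] at this
    simp at this hζ
    linarith
  have hint : ∀ i j, CircleIntegrable (Ψ i j) 0 1 := by
    intro i j
    refine ContinuousOn.circleIntegrable zero_le_one ?_
    change ContinuousOn (fun ζ => ((ζ - 0) / (ζ - z i)) * φ i j ζ) (sphere 0 1)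
    refine ContinuousOn.mul ?_ ((hφ i j).continuousOn.mono sphere_subset_closedBall)
    exact ContinuousOn.div (by fun_prop) (by fun_prop) (hsub i)
  have hsum : Real.circleAverage (fun ζ => ∑ i, ∑ j, Ψ i j ζ) 0 1 = ∑ i, ∑ j, φ i j (z i) := by
    rw [Real.circleAverage_fun_sum]
    · refine Finset.sum_congr rfl fun i _ => ?_
      rw [Real.circleAverage_fun_sum]
      · exact Finset.sum_congr rfl fun j _ => hav i j
      · intro j _; exact hint i j
    · intro i _
      exact CircleIntegrable.fun_sum _ fun j _ => hint i j
  have hint2 : CircleIntegrable (fun ζ => ∑ i, ∑ j, Ψ i j ζ) 0 1 :=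
    CircleIntegrable.fun_sum _ fun i _ => CircleIntegrable.fun_sum _ fun j _ => hint i j
  change 0 ≤ (∑ i, ∑ j, φ i j (z i)).re
  rw [← hsum]
  have hre := ContinuousLinearMap.circleAverage_comp_comm Complex.reCLM hint2
  rw [Complex.reCLM_apply] at hre
  rw [← hre]
  refine Real.circleAverage_nonneg_of_nonneg ?_
  intro ζ hζ
  rw [abs_one] at hζ
  have hζn : ‖ζ‖ = 1 := by simpa using hζ
  have hζζ : ζ * conj ζ = 1 := by
    rw [Complex.mul_conj, Complex.normSq_eq_norm_sq, hζn]; simp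
  let k : Fin N → ℂ := fun j => (1 - ζ * conj (z j))⁻¹
  have hk : ∀ i, (ζ - 0) / (ζ - z i) = conj (k i) := by
    intro i
    have h1 := hsub i ζ hζ
    have h2 : (1 - conj ζ * z i) ≠ 0 := by
      intro h0
      apply h1
      linear_combination ζ * h0 + z i * hζζ
    simp only [k, map_inv₀, map_sub, map_mul, map_one, Complex.conj_conj, sub_zero]
    rw [div_eq_iff h1, ← div_eq_inv_mul, eq_div_iff h2]
    linear_combination (- z i) * hζζ
  let f0 : F := ∑ j, k j • r j
  let g0 : E := ∑ j, k j • g j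
  have hρζ : (ρ : ℂ) * ζ ∈ ball (0 : ℂ) 1 := by
    rw [mem_ball_zero_iff, norm_mul, Complex.norm_real, Real.norm_of_nonneg hρ0.le, hζn, mul_one]
    exact hρ1
  have hexp : ∑ i, ∑ j, Ψ i j ζ = inner ℂ f0 f0 - 2 * inner ℂ f0 (T (ρ * ζ) g0)
      + inner ℂ g0 g0 := by
    rw [Finset.sum_comm]
    simp only [f0, g0, map_sum, sum_inner, inner_sum, map_smul, inner_smul_left, inner_smul_right,
      Finset.mul_sum, ← Finset.sum_sub_distrib, ← Finset.sum_add_distrib]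
    refine Finset.sum_congr rfl fun i _ => Finset.sum_congr rfl fun j _ => ?_
    simp only [Ψ, φ, hk, smul_eq_mul]
    change conj (k j) * (k i * _) = _
    ring
  change 0 ≤ (∑ i, ∑ j, Ψ i j ζ).re
  rw [hexp]
  have e1 := inner_self_eq_norm_sq (𝕜 := ℂ) f0
  have e2 := inner_self_eq_norm_sq (𝕜 := ℂ) g0
  have e3 := norm_sub_sq (𝕜 := ℂ) f0 (T (ρ * ζ) g0)
  have e4 := hc _ hρζ g0
  have e5 : ‖T (ρ * ζ) g0‖ ^ 2 ≤ ‖g0‖ ^ 2 := by gcongr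
  have e6 := sq_nonneg ‖f0 - T (ρ * ζ) g0‖
  simp only [RCLike.re_eq_complex_re] at e1 e2 e3
  simp only [Complex.add_re, Complex.sub_re, Complex.mul_re, Complex.re_ofNat, Complex.im_ofNat]
  linarith

lemma schur_pos {E F : Type*} [NormedAddCommGroup E] [InnerProductSpace ℂ E]
    [NormedAddCommGroup F] [InnerProductSpace ℂ F]
    (T : ℂ → (E →L[ℂ] F))
    (hT : ∀ f e, DifferentiableOn ℂ (fun z => inner ℂ f (T z e)) (ball 0 1))
    (hc : ∀ z ∈ ball (0 : ℂ) 1, ∀ e, ‖T z e‖ ≤ ‖e‖)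
    (a : ℂ → F) (b : ℂ → E)
    (hab : ∀ z ∈ ball (0 : ℂ) 1, ∀ e, inner ℂ (a z) (T z e) = inner ℂ (b z) e)
    (N : ℕ) (z : Fin N → ℂ) (hz : ∀ i, z i ∈ ball (0 : ℂ) 1) (y : Fin N → ℂ) :
    0 ≤ ∑ i : Fin N, ∑ j : Fin N, conj (y i) * y j *
      ((inner ℂ (a (z i)) (a (z j)) - inner ℂ (b (z i)) (b (z j))) / (1 - z i * conj (z j))) := by
  have hlim : Filter.Tendsto (fun ρ : ℝ => (∑ i : Fin N, ∑ j : Fin N, (1 - z i * conj (z j))⁻¹ *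
      (inner ℂ (y i • a (z i)) (y j • a (z j))
        - 2 * inner ℂ (y i • a (z i)) (T (ρ * z i) (y j • b (z j)))
        + inner ℂ (y i • b (z i)) (y j • b (z j)))).re) (nhdsWithin 1 (Set.Iio 1))
      (nhds (∑ i : Fin N, ∑ j : Fin N, (1 - z i * conj (z j))⁻¹ *
      (inner ℂ (y i • a (z i)) (y j • a (z j))
        - 2 * inner ℂ (y i • a (z i)) (T (z i) (y j • b (z j)))
        + inner ℂ (y i • b (z i)) (y j • b (z j)))).re) := by
    refine (Complex.continuous_re.tendsto _).comp ?_
    refine tendsto_finsetSum _ fun i _ => tendsto_finsetSum _ fun j _ => ?_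
    refine Filter.Tendsto.const_mul _ ?_
    refine Filter.Tendsto.add_const _ ?_
    refine Filter.Tendsto.const_sub _ ?_
    refine Filter.Tendsto.const_mul _ ?_
    have h1 : ContinuousAt (fun w => inner ℂ (y i • a (z i)) (T w (y j • b (z j)))) (z i) :=
      ((hT _ _).differentiableAt (isOpen_ball.mem_nhds (hz i))).continuousAt
    have h2 : Filter.Tendsto (fun ρ : ℝ => (ρ : ℂ) * z i) (nhdsWithin 1 (Set.Iio 1))
        (nhds (z i)) := by
      have : Continuous (fun ρ : ℝ => (ρ : ℂ) * z i) := by fun_prop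
      have h3 := this.tendsto 1
      simp only [Complex.ofReal_one, one_mul] at h3
      exact h3.mono_left nhdsWithin_le_nhds
    exact h1.tendsto.comp h2
  have hnn := ge_of_tendsto hlim (b := 0) (by
    have : Set.Ioo (0 : ℝ) 1 ∈ nhdsWithin 1 (Set.Iio 1) := Ioo_mem_nhdsLT zero_lt_one
    filter_upwards [this] with ρ hρ
    exact schur_avg T hT hc ρ hρ.1 hρ.2 N z hz (fun i => y i • a (z i)) (fun i => y i • b (z i)))
  have heq : (∑ i : Fin N, ∑ j : Fin N, (1 - z i * conj (z j))⁻¹ *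
      (inner ℂ (y i • a (z i)) (y j • a (z j))
        - 2 * inner ℂ (y i • a (z i)) (T (z i) (y j • b (z j)))
        + inner ℂ (y i • b (z i)) (y j • b (z j)))) = ∑ i : Fin N, ∑ j : Fin N, conj (y i) * y j *
      ((inner ℂ (a (z i)) (a (z j)) - inner ℂ (b (z i)) (b (z j))) / (1 - z i * conj (z j))) := by
    refine Finset.sum_congr rfl fun i _ => Finset.sum_congr rfl fun j _ => ?_
    simp only [inner_smul_left, inner_smul_right, map_smul, hab (z i) (hz i)]
    ring
  rw [heq] at hnn
  rw [Complex.le_def]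
  refine ⟨hnn, ?_⟩
  rw [Complex.zero_im, eq_comm, ← Complex.conj_eq_iff_im]
  simp only [map_sum]
  rw [Finset.sum_comm]
  refine Finset.sum_congr rfl fun i _ => Finset.sum_congr rfl fun j _ => ?_
  simp only [map_mul, map_div₀, map_sub, map_one, Complex.conj_conj, inner_conj_symm]
  ring

lemma kernel_id (𝒮 : ℂ → (lp (fun _ : ℕ => ℂ) 2 →L[ℂ] ℂ)) (h : ℂ → ℂ) (z w : ℂ)
    (hz : z ∈ ball (0 : ℂ) 1) (hw : w ∈ ball (0 : ℂ) 1)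
    (a : ℂ → WithLp 2 (ℂ × ℂ)) (ha : a = fun z => WithLp.toLp 2 (1, conj (z * h z)))
    (b : ℂ → WithLp 2 (lp (fun _ : ℕ => ℂ) 2 × ℂ))
    (hb : b = fun z => WithLp.toLp 2 (ContinuousLinearMap.adjoint (𝒮 z) 1, conj (h z))) :
    1 - z * conj w ≠ 0 ∧
    (inner ℂ (a z) (a w) - inner ℂ (b z) (b w)) / (1 - z * conj w) =
    (1 - 𝒮 z (ContinuousLinearMap.adjoint (𝒮 w) 1)) / (1 - z * conj w) - h z * conj (h w) := by
  have hne : 1 - z * conj w ≠ 0 := by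
    intro h0
    have h1 : ‖z * conj w‖ = 1 := by rw [← sub_eq_zero.mp h0]; simp
    rw [mem_ball_zero_iff] at hz hw
    rw [norm_mul, RCLike.norm_conj] at h1
    nlinarith [norm_nonneg z, norm_nonneg w]
  refine ⟨hne, ?_⟩
  have e1 : inner ℂ (a z) (a w) = 1 + z * h z * conj (w * h w) := by
    simp [ha, WithLp.prod_inner_apply]; ring
  have e2 : inner ℂ (b z) (b w) = 𝒮 z (ContinuousLinearMap.adjoint (𝒮 w) 1) + h z * conj (h w) := by
    rw [hb, WithLp.prod_inner_apply, ContinuousLinearMap.adjoint_inner_left]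
    simp; ring
  rw [e1, e2, map_mul]
  field_simp
  ring

/-- Characterization of the unit ball of a de Branges–Rovnyak space `H(K_𝒮)` for a Schur
function `𝒮 : 𝔻 → L(ℓ²(ℕ,ℂ), ℂ)`: the kernel `K_𝒮(z,w) − h(z)·conj(h(w))` is positive
semidefinite iff `h` and `𝒮` have a joint Redheffer-type representation through a
contractive analytic block function `Σ = (Σᵢⱼ)`. -/
theorem stmt10 (𝒮 : ℂ → (lp (fun _ : ℕ => ℂ) 2 →L[ℂ] ℂ))
    (h𝒮an : AnalyticOn ℂ 𝒮 (ball (0 : ℂ) 1))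
    (h𝒮c : ∀ z ∈ ball (0 : ℂ) 1, ‖𝒮 z‖ ≤ 1)
    (h : ℂ → ℂ) :
    (∀ (N : ℕ) (z : Fin N → ℂ), (∀ i, z i ∈ ball (0 : ℂ) 1) → ∀ y : Fin N → ℂ,
      0 ≤ ∑ i : Fin N, ∑ j : Fin N,
        conj (y i) * y j *
          ((1 - 𝒮 (z i) (ContinuousLinearMap.adjoint (𝒮 (z j)) 1))
              / (1 - z i * conj (z j))
            - h (z i) * conj (h (z j)))) ↔
    (∃ (Sig11 : ℂ → (lp (fun _ : ℕ => ℂ) 2 →L[ℂ] ℂ)) (Sig12 : ℂ → ℂ)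
       (Sig21 : ℂ → (lp (fun _ : ℕ => ℂ) 2 →L[ℂ] ℂ)) (Sig22 : ℂ → ℂ),
      AnalyticOn ℂ Sig11 (ball (0 : ℂ) 1) ∧ AnalyticOn ℂ Sig12 (ball (0 : ℂ) 1) ∧
      AnalyticOn ℂ Sig21 (ball (0 : ℂ) 1) ∧ AnalyticOn ℂ Sig22 (ball (0 : ℂ) 1) ∧
      (∀ z ∈ ball (0 : ℂ) 1, ∀ (u : lp (fun _ : ℕ => ℂ) 2) (lam : ℂ),
        ‖Sig11 z u + Sig12 z * lam‖ ^ 2 + ‖Sig21 z u + Sig22 z * lam‖ ^ 2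
          ≤ ‖u‖ ^ 2 + ‖lam‖ ^ 2) ∧
      (∀ z ∈ ball (0 : ℂ) 1,
        h z = Sig12 z * (1 - z * Sig22 z)⁻¹ ∧
        𝒮 z = Sig11 z + (z * Sig12 z * (1 - z * Sig22 z)⁻¹) • Sig21 z)) := by
  obtain ⟨a, ha⟩ : ∃ a : ℂ → WithLp 2 (ℂ × ℂ), a = fun z => WithLp.toLp 2 (1, conj (z * h z)) := ⟨_, rfl⟩
  obtain ⟨b, hb⟩ : ∃ b : ℂ → WithLp 2 (lp (fun _ : ℕ => ℂ) 2 × ℂ), b = fun z =>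
    WithLp.toLp 2 (ContinuousLinearMap.adjoint (𝒮 z) 1, conj (h z)) := ⟨_, rfl⟩
  have hker := fun z w hz hw => kernel_id 𝒮 h z w hz hw a ha b hb
  have hain : ∀ z f, inner ℂ (a z) f = f.fst + z * h z * f.snd := by
    intro z f
    simp [ha, WithLp.prod_inner_apply]; ring
  have hbin : ∀ z e, inner ℂ (b z) e = 𝒮 z e.fst + h z * e.snd := by
    intro z e
    rw [hb, WithLp.prod_inner_apply, ContinuousLinearMap.adjoint_inner_left]
    simp; ring
  let cE : lp (fun _ : ℕ => ℂ) 2 × ℂ →L[ℂ] WithLp 2 (lp (fun _ : ℕ => ℂ) 2 × ℂ) :=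
    (WithLp.prodContinuousLinearEquiv 2 ℂ (lp (fun _ : ℕ => ℂ) 2) ℂ).symm.toContinuousLinearMap
  let jU : lp (fun _ : ℕ => ℂ) 2 →L[ℂ] WithLp 2 (lp (fun _ : ℕ => ℂ) 2 × ℂ) := cE ∘L ContinuousLinearMap.inl ℂ _ ℂ
  let jC : ℂ →L[ℂ] WithLp 2 (lp (fun _ : ℕ => ℂ) 2 × ℂ) := cE ∘L ContinuousLinearMap.inr ℂ _ ℂ
  let dE : WithLp 2 (lp (fun _ : ℕ => ℂ) 2 × ℂ) →L[ℂ] lp (fun _ : ℕ => ℂ) 2 × ℂ :=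
    (WithLp.prodContinuousLinearEquiv 2 ℂ (lp (fun _ : ℕ => ℂ) 2) ℂ).toContinuousLinearMap
  let cF : WithLp 2 (ℂ × ℂ) →L[ℂ] ℂ × ℂ := (WithLp.prodContinuousLinearEquiv 2 ℂ ℂ ℂ).toContinuousLinearMap
  let dF : ℂ × ℂ →L[ℂ] WithLp 2 (ℂ × ℂ) := (WithLp.prodContinuousLinearEquiv 2 ℂ ℂ ℂ).symm.toContinuousLinearMap
  let p1 : WithLp 2 (ℂ × ℂ) →L[ℂ] ℂ := ContinuousLinearMap.fst ℂ ℂ ℂ ∘L cF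
  let p2 : WithLp 2 (ℂ × ℂ) →L[ℂ] ℂ := ContinuousLinearMap.snd ℂ ℂ ℂ ∘L cF
  constructor
  · intro hpos
    let K : ball (0 : ℂ) 1 → ball (0 : ℂ) 1 → ℂ := fun z w =>
      (inner ℂ (a z) (a w) - inner ℂ (b z) (b w)) / (1 - z * conj (w : ℂ))
    obtain ⟨H, i1, i2, i3, g, hg⟩ := exists_kernel_factor K
      (by
        intro z w
        simp only [K, map_div₀, map_sub, map_mul, map_one, Complex.conj_conj, inner_conj_symm]
        rw [mul_comm (conj (w : ℂ))])
      (by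
        intro N x y
        convert hpos N (fun i => x i) (fun i => (x i).2) y using 6 with i _ j _
        exact (hker _ _ (x i).2 (x j).2).2)
    obtain ⟨T, hTd, hTc, hTab⟩ := leech_realization a b g (by
      intro z w
      rw [hg]
      have h0 := (hker _ _ z.2 w.2).1
      simp only [K]
      field_simp
      ring)
    have hlt : ∀ z ∈ ball (0 : ℂ) 1, 1 - z * p2 (T z (jC 1)) ≠ 0 := by
      intro z hz h0
      have h1 : ‖z * p2 (T z (jC 1))‖ = 1 := by rw [← sub_eq_zero.mp h0]; simp
      have h2 : ‖p2 (T z (jC 1))‖ ≤ ‖T z (jC 1)‖ := by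
        have := WithLp.prod_norm_sq_eq_of_L2 (T z (jC 1))
        change _ = _ + ‖p2 (T z (jC 1))‖ ^ 2 at this
        refine (sq_le_sq₀ (norm_nonneg _) (norm_nonneg _)).mp ?_
        nlinarith [sq_nonneg ‖(T z (jC 1)).fst‖]
      have h3 := hTc z hz (jC 1)
      have h4 : ‖jC 1‖ ^ 2 = 1 := by
        rw [WithLp.prod_norm_sq_eq_of_L2]
        simp [jC, cE]
      have h5 : ‖jC 1‖ = 1 := by
        nlinarith [norm_nonneg (jC 1)]
      rw [mem_ball_zero_iff] at hz
      rw [norm_mul] at h1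
      nlinarith [norm_nonneg z, norm_nonneg (p2 (T z (jC 1)))]
    have hh : ∀ z ∈ ball (0 : ℂ) 1, h z =
        p1 (T z (jC 1)) * (1 - z * p2 (T z (jC 1)))⁻¹ := by
      intro z hz
      have h1 := hTab z hz (jC 1)
      rw [hain, hbin] at h1
      have h2 : (jC 1).fst = 0 := by simp [jC, cE]
      have h3 : (jC 1).snd = 1 := by simp [jC, cE]
      rw [h2, h3, map_zero] at h1
      change p1 (T z (jC 1)) + z * h z * p2 (T z (jC 1)) = _ at h1
      rw [← div_eq_mul_inv, eq_div_iff (hlt z hz)]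
      linear_combination -h1
    refine ⟨fun z => p1 ∘L (T z ∘L jU), fun z => p1 (T z (jC 1)), fun z => p2 ∘L (T z ∘L jU),
      fun z => p2 (T z (jC 1)), ?_, ?_, ?_, ?_, ?_, ?_⟩
    · refine DifferentiableOn.analyticOn ?_ isOpen_ball
      exact (differentiableOn_const _).clm_comp (hTd.clm_comp (differentiableOn_const _))
    · refine DifferentiableOn.analyticOn ?_ isOpen_ball
      exact p1.differentiable.comp_differentiableOn (hTd.clm_apply (differentiableOn_const _))
    · refine DifferentiableOn.analyticOn ?_ isOpen_ball
      exact (differentiableOn_const _).clm_comp (hTd.clm_comp (differentiableOn_const _))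
    · refine DifferentiableOn.analyticOn ?_ isOpen_ball
      exact p2.differentiable.comp_differentiableOn (hTd.clm_apply (differentiableOn_const _))
    · intro z hz u lam
      have h1 := hTc z hz (jU u + jC lam)
      have h2 := WithLp.prod_norm_sq_eq_of_L2 (T z (jU u + jC lam))
      change _ = ‖p1 _‖ ^ 2 + ‖p2 _‖ ^ 2 at h2
      have h3 := WithLp.prod_norm_sq_eq_of_L2 (jU u + jC lam)
      have h4 : (jU u + jC lam).fst = u := by simp [jU, jC, cE, WithLp.add_fst, WithLp.add_snd]
      have h5 : (jU u + jC lam).snd = lam := by simp [jU, jC, cE, WithLp.add_fst, WithLp.add_snd]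
      rw [h4, h5] at h3
      have h6 : jC lam = lam • jC 1 := by rw [← map_smul]; simp
      have h7 : ‖T z (jU u + jC lam)‖ ^ 2 ≤ ‖jU u + jC lam‖ ^ 2 := by gcongr
      rw [h2, h3, h6] at h7
      simpa [mul_comm] using h7
    · intro z hz
      refine ⟨hh z hz, ?_⟩
      ext1 u
      have h1 := hTab z hz (jU u)
      rw [hain, hbin] at h1
      have h2 : (jU u).fst = u := by simp [jU, cE]
      have h3 : (jU u).snd = 0 := by simp [jU, cE]
      rw [h2, h3] at h1
      change p1 (T z (jU u)) + z * h z * p2 (T z (jU u)) = _ at h1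
      change 𝒮 z u = p1 (T z (jU u)) + (z * p1 (T z (jC 1)) * (1 - z * p2 (T z (jC 1)))⁻¹)
        * p2 (T z (jU u))
      rw [mul_assoc z, ← hh z hz]
      linear_combination -h1
  · rintro ⟨S11, S12, S21, S22, a11, a12, a21, a22, hcon, hrep⟩ N z hz y
    let T : ℂ → (WithLp 2 (lp (fun _ : ℕ => ℂ) 2 × ℂ) →L[ℂ] WithLp 2 (ℂ × ℂ)) := fun z => dF ∘L
      ((S11 z ∘L (ContinuousLinearMap.fst ℂ _ ℂ) + S12 z • ContinuousLinearMap.snd ℂ _ ℂ).prod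
        (S21 z ∘L (ContinuousLinearMap.fst ℂ _ ℂ) + S22 z • ContinuousLinearMap.snd ℂ _ ℂ)) ∘L dE
    have hT1 : ∀ z e, (T z e).fst = S11 z e.fst + S12 z * e.snd := by
      intro z e; rfl
    have hT2 : ∀ z e, (T z e).snd = S21 z e.fst + S22 z * e.snd := by
      intro z e; rfl
    have hTc : ∀ z ∈ ball (0 : ℂ) 1, ∀ e, ‖T z e‖ ≤ ‖e‖ := by
      intro z hz e
      refine (sq_le_sq₀ (norm_nonneg _) (norm_nonneg _)).mp ?_
      rw [WithLp.prod_norm_sq_eq_of_L2, WithLp.prod_norm_sq_eq_of_L2, hT1, hT2]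
      exact hcon z hz _ _
    have hlt : ∀ z ∈ ball (0 : ℂ) 1, 1 - z * S22 z ≠ 0 := by
      intro z hz h0
      have h1 : ‖z * S22 z‖ = 1 := by rw [← sub_eq_zero.mp h0]; simp
      have h2 := hcon z hz 0 1
      simp only [map_zero, zero_add, mul_one, norm_zero, norm_one] at h2
      rw [mem_ball_zero_iff] at hz
      rw [norm_mul] at h1
      have h3 : ‖S22 z‖ ≤ 1 := by nlinarith [sq_nonneg ‖S12 z‖, norm_nonneg (S22 z)]
      nlinarith [norm_nonneg z, norm_nonneg (S22 z)]
    have key := schur_pos T (by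
        intro f e
        have hin : ∀ z, inner ℂ f (T z e) = (S11 z e.fst + S12 z * e.snd) * conj f.fst
            + (S21 z e.fst + S22 z * e.snd) * conj f.snd := by
          intro z
          rw [← hT1, ← hT2]
          simp [WithLp.prod_inner_apply]
        simp only [hin]
        have b1 := a11.differentiableOn.clm_apply (differentiableOn_const e.fst)
        have b2 := a21.differentiableOn.clm_apply (differentiableOn_const e.fst)
        have b3 := a12.differentiableOn
        have b4 := a22.differentiableOn
        fun_prop) hTc a b (by
        intro z hz e
        rw [hain, hbin, hT1, hT2]
        obtain ⟨h1, h2⟩ := hrep z hz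
        rw [mul_assoc z, ← h1] at h2
        rw [h2]
        have h3 : h z * (1 - z * S22 z) = S12 z := by
          rw [h1, inv_mul_cancel_right₀ (hlt z hz)]
        simp only [add_apply, smul_apply, smul_eq_mul]
        linear_combination (-e.snd) * h3) N z hz y
    convert key using 6 with i _ j _
    exact (hker _ _ (hz i) (hz j)).2.symm
end
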